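/- Let (Ω, μ) be a probability space, H a real Hilbert space, θ, θ* ∈ H, and v : Ω → H with v Bochner integrable and ‖v‖² integrable. Let g : Ω → ℝ be integrable with ∫_Ω g dμ ≥ 0, let L ≥ 0, M̄ ≥ 0, H_c > 0, and 0 < η ≤ 1/(2L). Suppose: (i) ⟨θ − θ*, ∫_Ω v dμ⟩ ≥ ∫_Ω g dμ; (ii) ∫_Ω ‖v‖² dμ ≤ 4L ∫_Ω g dμ + 2M̄; (iii) ∫_Ω g dμ ≥ (H_c/2) ‖θ − θ*‖². Then, with θ'(ω) = θ − η v(ω), ∫_Ω ‖θ'(ω) − θ*‖² dμ(ω) ≤ (1 − η H_c (1 − 2Lη)) ‖θ − θ*‖² + 2η² M̄. -/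

import Mathlib

open RealInnerProductSpace MeasureTheory

/-- Expansion of the mean squared norm of `x - η v` for a square-integrable random vector `v`. -/
theorem integral_norm_sub_smul_sq {Ω : Type*} [MeasurableSpace Ω] {μ : Measure Ω}
    [IsProbabilityMeasure μ] {H : Type*} [NormedAddCommGroup H] [InnerProductSpace ℝ H]
    [CompleteSpace H] {v : Ω → H} (hv : Integrable v μ)
    (hv2 : Integrable (fun ω => ‖v ω‖ ^ 2) μ) (x : H) (η : ℝ) :
    ∫ ω, ‖x - η • v ω‖ ^ 2 ∂μ =
      ‖x‖ ^ 2 - 2 * η * ⟪x, ∫ ω, v ω ∂μ⟫ + η ^ 2 * ∫ ω, ‖v ω‖ ^ 2 ∂μ := by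
  have hinner : Integrable (fun ω => 2 * η * ⟪x, v ω⟫) μ := (hv.const_inner x).const_mul _
  have expand (ω : Ω) :
      ‖x - η • v ω‖ ^ 2 = ‖x‖ ^ 2 - 2 * η * ⟪x, v ω⟫ + η ^ 2 * ‖v ω‖ ^ 2 := by
    rw [norm_sub_sq_real, inner_smul_right, norm_smul, mul_pow, Real.norm_eq_abs, sq_abs]
    ring
  simp_rw [expand]
  have hdiff : Integrable (fun ω => ‖x‖ ^ 2 - 2 * η * ⟪x, v ω⟫) μ :=
    (integrable_const _).sub hinner
  rw [integral_add hdiff (hv2.const_mul _),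
    integral_sub (integrable_const _) hinner, integral_const_mul, integral_const_mul,
    integral_inner hv]
  simp

/-- One-step bound under the bounded mean-square gradient-error assumption: the update
`θ' = θ - η v` with `0 < η ≤ 1/(2L)` satisfies
`∫ ‖θ' - θ*‖² ≤ (1 - η H_c (1 - 2Lη)) ‖θ - θ*‖² + 2η² M̄`. -/
theorem stmt_12 {Ω : Type*} [MeasurableSpace Ω] (μ : Measure Ω) [IsProbabilityMeasure μ]
    {H : Type*} [NormedAddCommGroup H] [InnerProductSpace ℝ H] [CompleteSpace H]
    (θ θstar : H) (v : Ω → H)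
    (hv : Integrable v μ)
    (hv2 : Integrable (fun ω => ‖v ω‖ ^ 2) μ)
    (g : Ω → ℝ) (hg : Integrable g μ) (hg0 : 0 ≤ ∫ ω, g ω ∂μ)
    (L Mbar Hc η : ℝ) (hL : 0 ≤ L) (hMbar : 0 ≤ Mbar) (hHc : 0 < Hc)
    (hη0 : 0 < η) (hη : η ≤ 1 / (2 * L))
    (hi : ⟪θ - θstar, ∫ ω, v ω ∂μ⟫ ≥ ∫ ω, g ω ∂μ)
    (hii : ∫ ω, ‖v ω‖ ^ 2 ∂μ ≤ 4 * L * (∫ ω, g ω ∂μ) + 2 * Mbar)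
    (hiii : ∫ ω, g ω ∂μ ≥ Hc / 2 * ‖θ - θstar‖ ^ 2) :
    ∫ ω, ‖(θ - η • v ω) - θstar‖ ^ 2 ∂μ ≤
      (1 - η * Hc * (1 - 2 * L * η)) * ‖θ - θstar‖ ^ 2 + 2 * η ^ 2 * Mbar := by
  have hL' : 0 < L := by
    rcases hL.eq_or_lt with rfl | h
    · simp at hη
      linarith
    · exact h
  have hstep : 0 ≤ 1 - 2 * L * η := by
    have := (le_div_iff₀ (by positivity)).mp hη
    linarith
  simp_rw [sub_right_comm θ _ θstar]
  rw [integral_norm_sub_smul_sq hv hv2]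
  have h₁ := mul_le_mul_of_nonneg_left hi (by positivity : 0 ≤ 2 * η)
  have h₂ := mul_le_mul_of_nonneg_left hii (sq_nonneg η)
  have h₃ := mul_le_mul_of_nonneg_left hiii (by positivity : 0 ≤ 2 * η * (1 - 2 * L * η))
  linarith
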